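/- Suppose p ≥ 2d + 1. Then every second-order critical point S ∈ St(d,p)^{⊗n} of f satisfies d_F(S,Z) ≤ ((2+√5)(p+d)/(p−2d)) · √(d/n) · max(‖Δ‖_op, ‖Tr_d(Δ)‖_op). -/

import Mathlib

open Matrix MeasureTheory ProbabilityTheory
open scoped BigOperators ENNReal

noncomputable section

/-- Frobenius inner product `⟨X, Y⟩ = Tr (X Yᵀ)`. -/
def finner {m k : Type*} [Fintype m] [Fintype k] (X Y : Matrix m k ℝ) : ℝ :=
  ∑ i, ∑ j, X i j * Y i j

/-- Frobenius norm. -/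
def frobNorm {m k : Type*} [Fintype m] [Fintype k] (X : Matrix m k ℝ) : ℝ :=
  Real.sqrt (∑ i, ∑ j, (X i j) ^ 2)

/-- Spectral (ℓ²-operator) norm of a real matrix. -/
def opNorm {m k : Type*} [Fintype m] [Fintype k] [DecidableEq k] (X : Matrix m k ℝ) : ℝ :=
  ‖LinearMap.toContinuousLinearMap (Matrix.toEuclideanLin X)‖

/-- The `(i,j)` d×d block of an (nd)×(nd) matrix. -/
def blk {n d : ℕ} (M : Matrix (Fin n × Fin d) (Fin n × Fin d) ℝ) (i j : Fin n) :
    Matrix (Fin d) (Fin d) ℝ := fun k l => M (i, k) (j, l)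

/-- The i-th d×p block row of an (nd)×p matrix. -/
def rowBlk {n d p : ℕ} (S : Matrix (Fin n × Fin d) (Fin p) ℝ) (i : Fin n) :
    Matrix (Fin d) (Fin p) ℝ := fun k l => S (i, k) l

/-- The i-th (nd)×d block column of an (nd)×(nd) matrix. -/
def colBlk {n d : ℕ} (M : Matrix (Fin n × Fin d) (Fin n × Fin d) ℝ) (i : Fin n) :
    Matrix (Fin n × Fin d) (Fin d) ℝ := fun q l => M q (i, l)

/-- All d×p block rows lie in the Stiefel manifold St(d,p) (for p = d: are orthogonal). -/
def StiefelBlocks {n d p : ℕ} (S : Matrix (Fin n × Fin d) (Fin p) ℝ) : Prop :=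
  ∀ i, rowBlk S i * (rowBlk S i)ᵀ = 1

/-- The vertical stack Z of n copies of the identity I_d. -/
def Zmat (n d : ℕ) : Matrix (Fin n × Fin d) (Fin d) ℝ := fun q l => if q.2 = l then 1 else 0

/-- Feasibility for the SDP relaxation: symmetric, PSD, identity diagonal blocks. -/
def sdpFeasible {n d : ℕ} (X : Matrix (Fin n × Fin d) (Fin n × Fin d) ℝ) : Prop :=
  X.IsSymm ∧ X.PosSemidef ∧ ∀ i, blk X i i = 1

/-- Global maximizer of the SDP relaxation with data `A`. -/
def sdpMaximizer {n d : ℕ} (A X : Matrix (Fin n × Fin d) (Fin n × Fin d) ℝ) : Prop :=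
  sdpFeasible X ∧ ∀ Y, sdpFeasible Y → finner A Y ≤ finner A X

/-- Global maximizer of the program (P) with data `A`. -/
def progPMaximizer {n d : ℕ} (A : Matrix (Fin n × Fin d) (Fin n × Fin d) ℝ)
    (R : Matrix (Fin n × Fin d) (Fin d) ℝ) : Prop :=
  StiefelBlocks R ∧
    ∀ R' : Matrix (Fin n × Fin d) (Fin d) ℝ, StiefelBlocks R' →
      finner A (R' * R'ᵀ) ≤ finner A (R * Rᵀ)

/-- The distance `d_F(S, Z) = min_{Q ∈ St(d,p)} ‖S − ZQ‖_F`. -/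
def dF {n d p : ℕ} (S : Matrix (Fin n × Fin d) (Fin p) ℝ) : ℝ :=
  sInf {c | ∃ Q : Matrix (Fin d) (Fin p) ℝ, Q * Qᵀ = 1 ∧ c = frobNorm (S - Zmat n d * Q)}

/-- `Λ_{ii}(S) = (1/2) Σ_j (S_i S_jᵀ A_{ji} + A_{ij} S_j S_iᵀ)`. -/
def Lam {n d p : ℕ} (A : Matrix (Fin n × Fin d) (Fin n × Fin d) ℝ)
    (S : Matrix (Fin n × Fin d) (Fin p) ℝ) (i : Fin n) : Matrix (Fin d) (Fin d) ℝ :=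
  (1 / 2 : ℝ) •
    ∑ j, (rowBlk S i * (rowBlk S j)ᵀ * blk A j i + blk A i j * rowBlk S j * (rowBlk S i)ᵀ)

/-- Block diagonal matrix with given d×d diagonal blocks. -/
def blkDiag {n d : ℕ} (D : Fin n → Matrix (Fin d) (Fin d) ℝ) :
    Matrix (Fin n × Fin d) (Fin n × Fin d) ℝ :=
  fun q r => if q.1 = r.1 then D q.1 q.2 r.2 else 0

/-- Local maximizer of `f(S) = ⟨A, S Sᵀ⟩` over `St(d,p)^{⊗n}`. -/
def isLocalMax {n d p : ℕ} (A : Matrix (Fin n × Fin d) (Fin n × Fin d) ℝ)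
    (S : Matrix (Fin n × Fin d) (Fin p) ℝ) : Prop :=
  StiefelBlocks S ∧ ∃ ε > (0 : ℝ), ∀ S' : Matrix (Fin n × Fin d) (Fin p) ℝ,
    StiefelBlocks S' → frobNorm (S' - S) < ε → finner A (S' * S'ᵀ) ≤ finner A (S * Sᵀ)

/-- First-order criticality: `Σ_j A_{ij} S_j = Λ_{ii}(S) S_i` for all i. -/
def firstOrderCrit {n d p : ℕ} (A : Matrix (Fin n × Fin d) (Fin n × Fin d) ℝ)
    (S : Matrix (Fin n × Fin d) (Fin p) ℝ) : Prop :=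
  ∀ i, (∑ j, blk A i j * rowBlk S j) = Lam A S i * rowBlk S i

/-- Second-order necessary inequality over tangent directions. -/
def secondOrderIneq {n d p : ℕ} (A : Matrix (Fin n × Fin d) (Fin n × Fin d) ℝ)
    (S : Matrix (Fin n × Fin d) (Fin p) ℝ) : Prop :=
  ∀ Y : Matrix (Fin n × Fin d) (Fin p) ℝ,
    (∀ i, rowBlk S i * (rowBlk Y i)ᵀ + rowBlk Y i * (rowBlk S i)ᵀ = 0) →
    ∑ i, ∑ j, finner (blk A i j) (rowBlk Y i * (rowBlk Y j)ᵀ) ≤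
      ∑ i, finner (Lam A S i) (rowBlk Y i * (rowBlk Y i)ᵀ)

/-- Second-order critical point of `f`. -/
def secondOrderCrit {n d p : ℕ} (A : Matrix (Fin n × Fin d) (Fin n × Fin d) ℝ)
    (S : Matrix (Fin n × Fin d) (Fin p) ℝ) : Prop :=
  StiefelBlocks S ∧ firstOrderCrit A S ∧ secondOrderIneq A S

/-- Partial trace `Tr_d(Δ) ∈ ℝ^{n×n}`. -/
def partialTrace {n d : ℕ} (Δ : Matrix (Fin n × Fin d) (Fin n × Fin d) ℝ) :
    Matrix (Fin n) (Fin n) ℝ := fun i j => (blk Δ i j).trace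

/-- Singular values of a d×p real matrix (square roots of the eigenvalues of `M Mᴴ`). -/
def singVals {d p : ℕ} (M : Matrix (Fin d) (Fin p) ℝ) (i : Fin d) : ℝ :=
  Real.sqrt ((Matrix.isHermitian_mul_conjTranspose_self M).eigenvalues i)

/-- Nuclear norm: sum of singular values. -/
def nuclearNorm {d p : ℕ} (M : Matrix (Fin d) (Fin p) ℝ) : ℝ :=
  ∑ i, singVals M i

/-- The law of the iid standard Gaussian coordinates indexing the noise. -/
def gaussianEnsemble (n d : ℕ) :
    Measure (((Fin n × Fin d) × (Fin n × Fin d)) → ℝ) :=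
  Measure.pi fun _ => gaussianReal 0 1

/-- The symmetric Gaussian random matrix `W` built from the iid coordinates:
`W_{ii} = 0`, the entries of `W_{ij}` for `i < j` are iid standard Gaussians, and
`W_{ji} = W_{ij}ᵀ`. -/
def Wof {n d : ℕ} (ω : ((Fin n × Fin d) × (Fin n × Fin d)) → ℝ) :
    Matrix (Fin n × Fin d) (Fin n × Fin d) ℝ :=
  fun q r => if q.1 < r.1 then ω (q, r) else if r.1 < q.1 then ω (r, q) else 0

section FrobeniusInner

variable {m k l : Type*} [Fintype m] [Fintype k] [Fintype l]

lemma finner_eq_trace (X Y : Matrix m k ℝ) : finner X Y = (X * Yᵀ).trace := by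
  simp [finner, Matrix.trace, Matrix.mul_apply]

lemma finner_comm (X Y : Matrix m k ℝ) : finner X Y = finner Y X := by
  simp [finner, mul_comm]

lemma finner_add_left (X Y V : Matrix m k ℝ) : finner (X + Y) V = finner X V + finner Y V := by
  simp [finner, add_mul, Finset.sum_add_distrib]

lemma finner_sub_left (X Y V : Matrix m k ℝ) : finner (X - Y) V = finner X V - finner Y V := by
  simp [finner, sub_mul, Finset.sum_sub_distrib]

lemma finner_sub_right (X Y V : Matrix m k ℝ) : finner V (X - Y) = finner V X - finner V Y := by
  simp [finner, mul_sub, Finset.sum_sub_distrib]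

lemma finner_sum_left {ι : Type*} [Fintype ι] (X : ι → Matrix m k ℝ) (V : Matrix m k ℝ) :
    finner (∑ i, X i) V = ∑ i, finner (X i) V := by
  simp only [finner_eq_trace, Matrix.sum_mul, Matrix.trace_sum]

lemma finner_self_nonneg (X : Matrix m k ℝ) : 0 ≤ finner X X :=
  Finset.sum_nonneg fun _ _ => Finset.sum_nonneg fun _ _ => mul_self_nonneg _

lemma frobNorm_nonneg (X : Matrix m k ℝ) : 0 ≤ frobNorm X := Real.sqrt_nonneg _

lemma frobNorm_eq_sqrt (X : Matrix m k ℝ) : frobNorm X = Real.sqrt (finner X X) := by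
  simp [frobNorm, finner, pow_two]

lemma frobNorm_sq (X : Matrix m k ℝ) : frobNorm X ^ 2 = finner X X := by
  rw [frobNorm_eq_sqrt, Real.sq_sqrt (finner_self_nonneg X)]

lemma finner_le_frobNorm_mul (X Y : Matrix m k ℝ) : finner X Y ≤ frobNorm X * frobNorm Y := by
  have h := Real.sum_mul_le_sqrt_mul_sqrt (Finset.univ : Finset (m × k))
    (fun q => X q.1 q.2) (fun q => Y q.1 q.2)
  simpa only [Fintype.sum_prod_type, finner, frobNorm] using h

lemma abs_finner_le (X Y : Matrix m k ℝ) : |finner X Y| ≤ frobNorm X * frobNorm Y := by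
  refine abs_le'.2 ⟨finner_le_frobNorm_mul X Y, ?_⟩
  have h := finner_le_frobNorm_mul (-X) Y
  simpa [finner, frobNorm] using h

lemma finner_mul_transpose (B : Matrix m l ℝ) (X : Matrix m k ℝ) (Y : Matrix l k ℝ) :
    finner B (X * Yᵀ) = finner (B * Y) X := by
  simp only [finner_eq_trace, Matrix.transpose_mul, Matrix.transpose_transpose, Matrix.mul_assoc]

lemma frobNorm_add_le (X Y : Matrix m k ℝ) : frobNorm (X + Y) ≤ frobNorm X + frobNorm Y := by
  have h := finner_le_frobNorm_mul X Y
  have e : finner (X + Y) (X + Y) = finner X X + 2 * finner X Y + finner Y Y := by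
    rw [finner_add_left, finner_comm X (X + Y), finner_comm Y (X + Y), finner_add_left,
      finner_add_left, finner_comm Y X]
    ring
  refine abs_le_of_sq_le_sq' ?_ (add_nonneg (frobNorm_nonneg X) (frobNorm_nonneg Y)) |>.2
  rw [frobNorm_sq, e, add_sq, frobNorm_sq, frobNorm_sq]
  linarith

lemma finner_sub_self (X Y : Matrix m k ℝ) :
    finner (X - Y) (X - Y) = finner X X - 2 * finner X Y + finner Y Y := by
  rw [finner_sub_left, finner_sub_right, finner_sub_right, finner_comm Y X]
  ring

lemma opNorm_nonneg [DecidableEq k] (X : Matrix m k ℝ) : 0 ≤ opNorm X := norm_nonneg _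

lemma sum_mulVec_sq_le [DecidableEq k] (B : Matrix m k ℝ) (v : k → ℝ) :
    ∑ i, (B *ᵥ v) i ^ 2 ≤ opNorm B ^ 2 * ∑ j, v j ^ 2 := by
  have h := (LinearMap.toContinuousLinearMap (Matrix.toEuclideanLin B)).le_opNorm
    (WithLp.toLp 2 v)
  have h2 := pow_le_pow_left₀ (norm_nonneg _) h 2
  rw [mul_pow, EuclideanSpace.norm_sq_eq, EuclideanSpace.norm_sq_eq] at h2
  simpa [opNorm, Matrix.toLpLin_apply] using h2

lemma finner_mul_self_le [DecidableEq l] (B : Matrix m l ℝ) (X : Matrix l k ℝ) :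
    finner (B * X) (B * X) ≤ opNorm B ^ 2 * finner X X := by
  have h : ∀ c, ∑ i, (B * X) i c ^ 2 ≤ opNorm B ^ 2 * ∑ j, X j c ^ 2 := fun c =>
    sum_mulVec_sq_le B fun j => X j c
  simp only [finner, ← pow_two]
  rw [Finset.sum_comm, Finset.sum_comm (f := fun i j => X i j ^ 2), Finset.mul_sum]
  exact Finset.sum_le_sum fun c _ => h c

lemma frobNorm_mul_le [DecidableEq l] (B : Matrix m l ℝ) (X : Matrix l k ℝ) :
    frobNorm (B * X) ≤ opNorm B * frobNorm X := by
  refine abs_le_of_sq_le_sq' ?_ (mul_nonneg (opNorm_nonneg B) (frobNorm_nonneg X)) |>.2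
  rw [mul_pow, frobNorm_sq, frobNorm_sq]
  exact finner_mul_self_le B X

lemma abs_finner_gram_sub_le [DecidableEq m] {B : Matrix m m ℝ} (hB : B.IsSymm)
    (X Y : Matrix m k ℝ) :
    |finner B (X * Xᵀ) - finner B (Y * Yᵀ)| ≤
      opNorm B * frobNorm (X - Y) * (frobNorm X + frobNorm Y) := by
  have hs : finner (B * X) Y = finner (B * Y) X := by
    rw [finner_eq_trace, finner_eq_trace, ← Matrix.trace_transpose (B * Y * Xᵀ)]
    simp only [Matrix.transpose_mul, Matrix.transpose_transpose, hB.eq]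
    rw [← Matrix.mul_assoc, Matrix.trace_mul_comm _ B, Matrix.mul_assoc]
  have e : finner B (X * Xᵀ) - finner B (Y * Yᵀ) = finner (B * (X - Y)) (X + Y) := by
    rw [finner_mul_transpose, finner_mul_transpose, Matrix.mul_sub, finner_comm _ (X + Y),
      finner_add_left, finner_comm X, finner_comm Y, finner_sub_left, finner_sub_left, hs]
    ring
  rw [e]
  refine (abs_finner_le _ _).trans (mul_le_mul (frobNorm_mul_le _ _) (frobNorm_add_le _ _)
    (frobNorm_nonneg _) (mul_nonneg (opNorm_nonneg B) (frobNorm_nonneg _)))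

lemma finner_sum_self_le {n : ℕ} (X : Fin n → Matrix m k ℝ) :
    finner (∑ i, X i) (∑ i, X i) ≤ n * ∑ i, finner (X i) (X i) := by
  have h : ∀ a c, (∑ i, X i a c) ^ 2 ≤ n * ∑ i, X i a c ^ 2 := fun a c => by
    simpa using sq_sum_le_card_mul_sum_sq (s := Finset.univ) (f := fun i => X i a c)
  simp only [finner, ← pow_two, Matrix.sum_apply]
  calc _ ≤ ∑ a, ∑ c, n * ∑ i, X i a c ^ 2 :=
        Finset.sum_le_sum fun a _ => Finset.sum_le_sum fun c _ => h a c
    _ = _ := by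
        simp only [← Finset.mul_sum]
        congr 1
        exact (Finset.sum_congr rfl fun a _ => Finset.sum_comm).trans Finset.sum_comm

lemma finner_mul_one_sub_proj [DecidableEq m] [DecidableEq k] {Q : Matrix m k ℝ}
    (hQ : Q * Qᵀ = 1) (X : Matrix l k ℝ) :
    finner (X * (1 - Qᵀ * Q)) (X * (1 - Qᵀ * Q)) = finner X X - finner (X * Qᵀ) (X * Qᵀ) := by
  have h : (1 - Qᵀ * Q) * (1 - Qᵀ * Q) = 1 - Qᵀ * Q := by
    have h2 : Qᵀ * Q * (Qᵀ * Q) = Qᵀ * Q := by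
      rw [Matrix.mul_assoc, ← Matrix.mul_assoc Q, hQ, Matrix.one_mul]
    rw [Matrix.mul_sub, Matrix.sub_mul, Matrix.sub_mul, h2]
    simp
  have ht : (1 - Qᵀ * Q)ᵀ = 1 - Qᵀ * Q := by simp
  rw [finner_eq_trace, Matrix.transpose_mul, ht, Matrix.mul_assoc, ← Matrix.mul_assoc _ _ Xᵀ, h,
    Matrix.sub_mul, Matrix.mul_sub, Matrix.trace_sub, finner_eq_trace, finner_eq_trace]
  simp [Matrix.mul_assoc]

lemma finner_gram_gram (X Y : Matrix m k ℝ) :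
    finner (Xᵀ * X) (Yᵀ * Y) = finner (X * Yᵀ) (X * Yᵀ) := by
  rw [finner_eq_trace, finner_eq_trace, Matrix.mul_assoc, Matrix.trace_mul_comm]
  simp [Matrix.mul_assoc]

lemma finner_self_of_mul_transpose_eq_one [DecidableEq m] {X : Matrix m k ℝ} (hX : X * Xᵀ = 1) :
    finner X X = Fintype.card m := by
  simp [finner_eq_trace, hX]

lemma finner_one_one [DecidableEq m] : finner (1 : Matrix m m ℝ) 1 = Fintype.card m := by
  simp [finner_eq_trace]

lemma finner_proj_sub_le [DecidableEq m] {X Y : Matrix m k ℝ} (hX : X * Xᵀ = 1)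
    (hY : Y * Yᵀ = 1) :
    finner (Xᵀ * X - Yᵀ * Y) (Xᵀ * X - Yᵀ * Y) ≤ 2 * finner (X - Y) (X - Y) := by
  have h := finner_self_nonneg (X * Yᵀ - 1)
  have h1 : finner (X * Yᵀ) 1 = finner X Y := by simp [finner_eq_trace]
  rw [finner_sub_self, h1, finner_one_one] at h
  rw [finner_sub_self, finner_sub_self, finner_gram_gram, finner_gram_gram, finner_gram_gram, hX,
    hY, finner_one_one, finner_self_of_mul_transpose_eq_one hX,
    finner_self_of_mul_transpose_eq_one hY]
  linarith

end FrobeniusInner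

section Blocks

variable {n d p : ℕ}

lemma finner_eq_sum_rowBlk (S T : Matrix (Fin n × Fin d) (Fin p) ℝ) :
    finner S T = ∑ i, finner (rowBlk S i) (rowBlk T i) := by
  simp [finner, rowBlk, Fintype.sum_prod_type]

lemma finner_eq_sum_blk (B : Matrix (Fin n × Fin d) (Fin n × Fin d) ℝ)
    (S T : Matrix (Fin n × Fin d) (Fin p) ℝ) :
    finner B (S * Tᵀ) = ∑ i, ∑ j, finner (blk B i j) (rowBlk S i * (rowBlk T j)ᵀ) := by
  simp only [finner, blk, rowBlk, Fintype.sum_prod_type, Matrix.mul_apply, Matrix.transpose_apply]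
  exact Finset.sum_congr rfl fun i _ => Finset.sum_comm

lemma rowBlk_mul (B : Matrix (Fin n × Fin d) (Fin n × Fin d) ℝ)
    (S : Matrix (Fin n × Fin d) (Fin p) ℝ) (i : Fin n) :
    rowBlk (B * S) i = ∑ j, blk B i j * rowBlk S j := by
  ext a c
  simp [rowBlk, blk, Matrix.mul_apply, Fintype.sum_prod_type, Matrix.sum_apply]

lemma rowBlk_Zmat_mul (Q : Matrix (Fin d) (Fin p) ℝ) (i : Fin n) :
    rowBlk (Zmat n d * Q) i = Q := by
  ext a c
  simp [rowBlk, Zmat, Matrix.mul_apply]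

lemma blk_Zmat_mul_transpose_add (Δ : Matrix (Fin n × Fin d) (Fin n × Fin d) ℝ) (i j : Fin n) :
    blk (Zmat n d * (Zmat n d)ᵀ + Δ) i j = 1 + blk Δ i j := by
  ext a c
  simp [blk, Zmat, Matrix.mul_apply, Matrix.one_apply]

lemma partialTrace_isSymm {Δ : Matrix (Fin n × Fin d) (Fin n × Fin d) ℝ} (h : Δ.IsSymm) :
    (partialTrace Δ).IsSymm := by
  ext i j
  simp only [Matrix.transpose_apply, partialTrace, Matrix.trace, Matrix.diag, blk]
  exact Finset.sum_congr rfl fun a _ => h.apply _ _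

lemma sum_trace_Lam (A : Matrix (Fin n × Fin d) (Fin n × Fin d) ℝ)
    (S : Matrix (Fin n × Fin d) (Fin p) ℝ) :
    ∑ i, (Lam A S i).trace = ∑ i, ∑ j, finner (blk A i j) (rowBlk S i * (rowBlk S j)ᵀ) := by
  have e : ∀ i j, (rowBlk S i * (rowBlk S j)ᵀ * blk A j i).trace =
      finner (blk A j i) (rowBlk S j * (rowBlk S i)ᵀ) := fun i j => by
    rw [finner_eq_trace, Matrix.trace_mul_comm]
    simp
  have e' : ∀ i j, (blk A i j * rowBlk S j * (rowBlk S i)ᵀ).trace =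
      finner (blk A i j) (rowBlk S i * (rowBlk S j)ᵀ) := fun i j => by
    rw [finner_eq_trace]
    simp [Matrix.mul_assoc]
  simp only [Lam, Matrix.trace_smul, Matrix.trace_sum, Matrix.trace_add, e, e',
    Finset.sum_add_distrib, smul_eq_mul, ← Finset.mul_sum]
  rw [Finset.sum_comm]
  ring

lemma sum_finner_single_mul (B : Matrix (Fin d) (Fin d) ℝ) (R R' : Matrix (Fin p) (Fin p) ℝ) :
    ∑ a : Fin d, ∑ c : Fin p, finner B
      ((Matrix.single a c (1 : ℝ) * R) * (Matrix.single a c (1 : ℝ) * R')ᵀ) =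
      B.trace * (R * R'ᵀ).trace := by
  have e : ∀ (a : Fin d) (c : Fin p), finner B
      ((Matrix.single a c (1 : ℝ) * R) * (Matrix.single a c (1 : ℝ) * R')ᵀ) =
      B a a * (R * R'ᵀ) c c := fun a c => by
    rw [Matrix.transpose_mul, Matrix.transpose_single, Matrix.mul_assoc, ← Matrix.mul_assoc R,
      ← Matrix.mul_assoc, Matrix.single_mul_mul_single, finner_eq_trace, Matrix.transpose_single,
      Matrix.trace_mul_single]
    simp
  simp only [e, Matrix.trace, Matrix.diag, Finset.sum_mul, Finset.mul_sum]
  exact Finset.sum_comm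

lemma trace_one_sub_proj_mul {X Y : Matrix (Fin d) (Fin p) ℝ} (hX : X * Xᵀ = 1)
    (hY : Y * Yᵀ = 1) :
    ((1 - Xᵀ * X) * (1 - Yᵀ * Y)ᵀ).trace =
      p - 2 * d + finner (X * Yᵀ) (X * Yᵀ) := by
  have h1 : (Xᵀ * X).trace = d := by rw [Matrix.trace_mul_comm, hX]; simp
  have h2 : (Yᵀ * Y).trace = d := by rw [Matrix.trace_mul_comm, hY]; simp
  have h3 : (Xᵀ * X * (Yᵀ * Y)).trace = finner (X * Yᵀ) (X * Yᵀ) := by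
    rw [finner_eq_trace, Matrix.mul_assoc, Matrix.trace_mul_comm]
    simp [Matrix.mul_assoc]
  simp only [Matrix.transpose_sub, Matrix.transpose_mul, Matrix.transpose_transpose,
    Matrix.transpose_one, Matrix.mul_sub, Matrix.sub_mul, Matrix.trace_sub, Matrix.mul_one,
    Matrix.one_mul, h1, h2, h3, Matrix.trace_one, Fintype.card_fin]
  ring

/-- The second-order inequality summed over the tangent directions
`Φ (I - S_iᵀ S_i)`, with `Φ` running over the standard basis of `ℝ^{d×p}`. -/
lemma sum_trace_le_of_secondOrderIneq {A : Matrix (Fin n × Fin d) (Fin n × Fin d) ℝ}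
    {S : Matrix (Fin n × Fin d) (Fin p) ℝ} (hS : StiefelBlocks S) (h : secondOrderIneq A S) :
    ∑ i, ∑ j, (blk A i j).trace *
        (p - 2 * d + finner (rowBlk S i * (rowBlk S j)ᵀ) (rowBlk S i * (rowBlk S j)ᵀ)) ≤
      (p - d) * ∑ i, (Lam A S i).trace := by
  set R : Fin n → Matrix (Fin p) (Fin p) ℝ := fun i => 1 - (rowBlk S i)ᵀ * rowBlk S i with hR
  have hSR : ∀ i, rowBlk S i * (R i)ᵀ = 0 := fun i => by
    simp [hR, Matrix.mul_sub, ← Matrix.mul_assoc, hS i]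
  have key : ∀ (a : Fin d) (c : Fin p), _ := fun a c =>
    h (fun q s => (Matrix.single a c (1 : ℝ) * R q.1) q.2 s) (fun i => by
      change rowBlk S i * (Matrix.single a c (1 : ℝ) * R i)ᵀ +
        (Matrix.single a c (1 : ℝ) * R i) * (rowBlk S i)ᵀ = 0
      have h2 : R i * (rowBlk S i)ᵀ = 0 := by
        rw [← Matrix.transpose_transpose (R i), ← Matrix.transpose_mul, hSR, Matrix.transpose_zero]
      rw [Matrix.transpose_mul, ← Matrix.mul_assoc, hSR, Matrix.mul_assoc, h2]
      simp)
  have hrow : ∀ (a : Fin d) (c : Fin p) (i : Fin n),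
      rowBlk (fun (q : Fin n × Fin d) s => (Matrix.single a c (1 : ℝ) * R q.1) q.2 s) i =
        Matrix.single a c (1 : ℝ) * R i := fun _ _ _ => rfl
  have hsum := Finset.sum_le_sum fun a (_ : a ∈ Finset.univ) =>
    Finset.sum_le_sum fun c (_ : c ∈ Finset.univ) => key a c
  simp only [hrow] at hsum
  have swap : ∀ F : Fin d → Fin p → Fin n → ℝ,
      ∑ a, ∑ c, ∑ i, F a c i = ∑ i, ∑ a, ∑ c, F a c i := fun F =>
    (Finset.sum_congr rfl fun a _ => Finset.sum_comm).trans Finset.sum_comm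
  rw [swap, swap] at hsum
  simp only [swap, sum_finner_single_mul] at hsum
  have hT : ∀ i j, (R i * (R j)ᵀ).trace = _ := fun i j => trace_one_sub_proj_mul (hS i) (hS j)
  have hdd : ∀ i, finner (rowBlk S i * (rowBlk S i)ᵀ) (rowBlk S i * (rowBlk S i)ᵀ) = (d : ℝ) :=
    fun i => by rw [hS i, finner_eq_trace]; simp
  simp only [hT, hdd, ← Finset.sum_mul] at hsum
  linarith

lemma StiefelBlocks.finner_self {S : Matrix (Fin n × Fin d) (Fin p) ℝ} (hS : StiefelBlocks S) :
    finner S S = n * d := by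
  rw [finner_eq_sum_rowBlk]
  simp [finner_self_of_mul_transpose_eq_one (hS _)]

lemma StiefelBlocks.frobNorm_eq {S : Matrix (Fin n × Fin d) (Fin p) ℝ} (hS : StiefelBlocks S) :
    frobNorm S = Real.sqrt (n * d) := by
  rw [frobNorm_eq_sqrt, hS.finner_self]

lemma stiefelBlocks_Zmat_mul {Q : Matrix (Fin d) (Fin p) ℝ} (hQ : Q * Qᵀ = 1) :
    StiefelBlocks (Zmat n d * Q) := fun i => by
  rw [rowBlk_Zmat_mul, hQ]

/-- The `n × p²` matrix whose `i`-th row is the flattened projection `S_iᵀ S_i`. -/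
def projRows (S : Matrix (Fin n × Fin d) (Fin p) ℝ) : Matrix (Fin n) (Fin p × Fin p) ℝ :=
  fun i c => ((rowBlk S i)ᵀ * rowBlk S i) c.1 c.2

lemma projRows_mul_transpose (S : Matrix (Fin n × Fin d) (Fin p) ℝ) (i j : Fin n) :
    (projRows S * (projRows S)ᵀ) i j =
      finner (rowBlk S i * (rowBlk S j)ᵀ) (rowBlk S i * (rowBlk S j)ᵀ) := by
  rw [← finner_gram_gram]
  simp only [Matrix.mul_apply (M := projRows S), Matrix.transpose_apply, projRows, finner,
    Fintype.sum_prod_type]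

lemma frobNorm_projRows {S : Matrix (Fin n × Fin d) (Fin p) ℝ} (hS : StiefelBlocks S) :
    frobNorm (projRows S) = Real.sqrt (n * d) := by
  rw [frobNorm_eq_sqrt, finner_eq_trace, Matrix.trace]
  simp only [Matrix.diag, projRows_mul_transpose, hS _, finner_one_one]
  simp

lemma frobNorm_projRows_sub_le {S T : Matrix (Fin n × Fin d) (Fin p) ℝ} (hS : StiefelBlocks S)
    (hT : StiefelBlocks T) :
    frobNorm (projRows S - projRows T) ≤ Real.sqrt 2 * frobNorm (S - T) := by
  rw [frobNorm_eq_sqrt, frobNorm_eq_sqrt, ← Real.sqrt_mul (by norm_num)]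
  refine Real.sqrt_le_sqrt ?_
  have e : finner (projRows S - projRows T) (projRows S - projRows T) =
      ∑ i, finner ((rowBlk S i)ᵀ * rowBlk S i - (rowBlk T i)ᵀ * rowBlk T i)
        ((rowBlk S i)ᵀ * rowBlk S i - (rowBlk T i)ᵀ * rowBlk T i) := by
    simp only [finner, Fintype.sum_prod_type, projRows, Matrix.sub_apply]
  rw [e, finner_eq_sum_rowBlk, Finset.mul_sum]
  exact Finset.sum_le_sum fun i _ => finner_proj_sub_le (hS i) (hT i)

/-- For a first-order critical point, the block Gram matrix `S Sᵀ` has squared Frobenius norm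
at least `‖Zᵀ S‖_F² - d ‖Δ‖²`. -/
lemma le_sum_finner_of_firstOrderCrit (hn : 0 < n)
    {Δ : Matrix (Fin n × Fin d) (Fin n × Fin d) ℝ} {S : Matrix (Fin n × Fin d) (Fin p) ℝ}
    (hS : StiefelBlocks S) (h : firstOrderCrit (Zmat n d * (Zmat n d)ᵀ + Δ) S) :
    finner (∑ i, rowBlk S i) (∑ i, rowBlk S i) - d * opNorm Δ ^ 2 ≤
      ∑ i, ∑ j, finner (rowBlk S i * (rowBlk S j)ᵀ) (rowBlk S i * (rowBlk S j)ᵀ) := by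
  set W := ∑ i, rowBlk S i with hW
  have hres : ∀ i, finner W W - finner (W * (rowBlk S i)ᵀ) (W * (rowBlk S i)ᵀ) ≤
      finner (rowBlk (Δ * S) i) (rowBlk (Δ * S) i) := fun i => by
    set P := 1 - (rowBlk S i)ᵀ * rowBlk S i with hP
    have hSP : rowBlk S i * P = 0 := by
      simp [hP, Matrix.mul_sub, ← Matrix.mul_assoc, hS i]
    have h1 : W + rowBlk (Δ * S) i = Lam (Zmat n d * (Zmat n d)ᵀ + Δ) S i * rowBlk S i := by
      rw [← h i, rowBlk_mul, hW]
      simp only [blk_Zmat_mul_transpose_add, Matrix.add_mul, Matrix.one_mul,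
        Finset.sum_add_distrib]
    have h2 : W * P = -(rowBlk (Δ * S) i * P) := by
      rw [eq_neg_iff_add_eq_zero, ← Matrix.add_mul, h1, Matrix.mul_assoc, hSP, Matrix.mul_zero]
    rw [← finner_mul_one_sub_proj (hS i), ← hP, h2]
    have h3 := finner_mul_one_sub_proj (hS i) (rowBlk (Δ * S) i)
    rw [← hP] at h3
    have h4 := finner_self_nonneg (rowBlk (Δ * S) i * (rowBlk S i)ᵀ)
    have h5 : ∀ Y : Matrix (Fin d) (Fin p) ℝ, finner (-Y) (-Y) = finner Y Y := fun Y => by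
      simp [finner]
    rw [h5, h3]
    linarith
  have hsum := Finset.sum_le_sum fun i (_ : i ∈ Finset.univ) => hres i
  rw [← finner_eq_sum_rowBlk, Finset.sum_sub_distrib, Finset.sum_const, Finset.card_univ,
    Fintype.card_fin, nsmul_eq_mul] at hsum
  have hop := finner_mul_self_le Δ S
  rw [hS.finner_self] at hop
  have hcs : ∑ j, finner (W * (rowBlk S j)ᵀ) (W * (rowBlk S j)ᵀ) ≤
      n * ∑ i, ∑ j, finner (rowBlk S i * (rowBlk S j)ᵀ) (rowBlk S i * (rowBlk S j)ᵀ) := by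
    rw [Finset.sum_comm, Finset.mul_sum]
    refine Finset.sum_le_sum fun j _ => ?_
    rw [hW, Matrix.sum_mul]
    exact finner_sum_self_le fun i => rowBlk S i * (rowBlk S j)ᵀ
  have hn' : (0 : ℝ) < n := by exact_mod_cast hn
  refine le_of_mul_le_mul_left ?_ hn'
  linarith

lemma exists_frobNorm_sub_Zmat_mul_le (hn : 0 < n) {S : Matrix (Fin n × Fin d) (Fin p) ℝ}
    (hS : StiefelBlocks S) :
    ∃ Q : Matrix (Fin d) (Fin p) ℝ, Q * Qᵀ = 1 ∧ n * frobNorm (S - Zmat n d * Q) ^ 2 ≤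
      2 * ((n : ℝ) ^ 2 * d - finner (∑ i, rowBlk S i) (∑ i, rowBlk S i)) := by
  have : Nonempty (Fin n) := ⟨⟨0, hn⟩⟩
  set W := ∑ i, rowBlk S i with hW
  obtain ⟨k, -, hk⟩ := Finset.exists_le_of_sum_le (s := (Finset.univ : Finset (Fin n)))
    (f := fun _ => finner W W) (g := fun i => n * finner (rowBlk S i) W)
    Finset.univ_nonempty (by
      rw [← Finset.mul_sum, ← finner_sum_left (fun i => rowBlk S i), ← hW]
      simp)
  refine ⟨rowBlk S k, hS k, ?_⟩
  have e : finner S (Zmat n d * rowBlk S k) = finner (rowBlk S k) W := by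
    rw [finner_eq_sum_rowBlk]
    simp only [rowBlk_Zmat_mul]
    rw [← finner_sum_left, finner_comm]
  rw [frobNorm_sq, finner_sub_self, hS.finner_self, e,
    (stiefelBlocks_Zmat_mul (n := n) (hS k)).finner_self]
  linarith

lemma dF_le_frobNorm {S : Matrix (Fin n × Fin d) (Fin p) ℝ} {Q : Matrix (Fin d) (Fin p) ℝ}
    (hQ : Q * Qᵀ = 1) : dF S ≤ frobNorm (S - Zmat n d * Q) :=
  csInf_le ⟨0, by rintro _ ⟨Q', -, rfl⟩; exact frobNorm_nonneg _⟩ ⟨Q, hQ, rfl⟩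

/-- Signal terms of the averaged second-order inequality are dominated by the differences of
the noise terms at `S` and at the aligned point `Z Q`. -/
lemma signal_le_noise {Δ : Matrix (Fin n × Fin d) (Fin n × Fin d) ℝ}
    {S : Matrix (Fin n × Fin d) (Fin p) ℝ} (hS : StiefelBlocks S)
    (h : secondOrderIneq (Zmat n d * (Zmat n d)ᵀ + Δ) S) {Q : Matrix (Fin d) (Fin p) ℝ}
    (hQ : Q * Qᵀ = 1) :
    d * (p - 2 * d) * (n : ℝ) ^ 2 +
        d * ∑ i, ∑ j, finner (rowBlk S i * (rowBlk S j)ᵀ) (rowBlk S i * (rowBlk S j)ᵀ) -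
        (p - d) * finner (∑ i, rowBlk S i) (∑ i, rowBlk S i) ≤
      (p - d) * (finner Δ (S * Sᵀ) - finner Δ ((Zmat n d * Q) * (Zmat n d * Q)ᵀ)) -
        (finner (partialTrace Δ) (projRows S * (projRows S)ᵀ) -
          finner (partialTrace Δ)
            (projRows (Zmat n d * Q) * (projRows (Zmat n d * Q))ᵀ)) := by
  have hso := sum_trace_le_of_secondOrderIneq hS h
  rw [sum_trace_Lam] at hso
  have hW : finner (∑ i, rowBlk S i) (∑ i, rowBlk S i) =
      ∑ i, ∑ j, finner 1 (rowBlk S i * (rowBlk S j)ᵀ) := by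
    rw [finner_sum_left]
    refine Finset.sum_congr rfl fun i _ => ?_
    rw [finner_comm, finner_sum_left]
    refine Finset.sum_congr rfl fun j _ => ?_
    rw [finner_mul_transpose, Matrix.one_mul]
  have hE0 : finner Δ ((Zmat n d * Q) * (Zmat n d * Q)ᵀ) = ∑ i, ∑ j, (blk Δ i j).trace := by
    rw [finner_eq_sum_blk]
    simp only [rowBlk_Zmat_mul, hQ, finner_eq_trace, Matrix.transpose_one, Matrix.mul_one]
  have hG : finner (partialTrace Δ) (projRows S * (projRows S)ᵀ) = ∑ i, ∑ j, (blk Δ i j).trace *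
      finner (rowBlk S i * (rowBlk S j)ᵀ) (rowBlk S i * (rowBlk S j)ᵀ) := by
    rw [finner]
    simp only [projRows_mul_transpose, partialTrace]
  have hG0 : finner (partialTrace Δ)
      (projRows (Zmat n d * Q) * (projRows (Zmat n d * Q))ᵀ) =
      d * ∑ i, ∑ j, (blk Δ i j).trace := by
    rw [finner]
    simp only [projRows_mul_transpose, partialTrace, rowBlk_Zmat_mul, hQ,
      finner_one_one, Fintype.card_fin, ← Finset.sum_mul]
    ring
  simp only [blk_Zmat_mul_transpose_add, Matrix.trace_add, Matrix.trace_one, Fintype.card_fin,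
    finner_add_left, add_mul, mul_add, Finset.sum_add_distrib, ← Finset.mul_sum,
    ← Finset.sum_mul, Finset.sum_const, Finset.card_univ, nsmul_eq_mul] at hso
  rw [← hW, ← finner_eq_sum_blk, ← hG, ← hE0] at hso
  rw [hG0, ← hE0]
  linarith

end Blocks

lemma le_of_signal_le_noise {n d p δ D w e g : ℝ} (hn : 0 < n) (hd : 1 ≤ d) (hp : 2 * d < p)
    (hδ : 0 ≤ δ) (hD : 0 ≤ D)
    (h : (p - 2 * d) * (n ^ 2 * d - w) ≤ d ^ 2 * δ ^ 2 + (p - d) * e + g)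
    (he : e ≤ δ * D * (2 * Real.sqrt (n * d)))
    (hg : g ≤ δ * (Real.sqrt 2 * D) * (2 * Real.sqrt (n * d)))
    (hw : n * D ^ 2 ≤ 2 * (n ^ 2 * d - w)) :
    D ≤ (2 + Real.sqrt 5) * (p + d) / (p - 2 * d) * Real.sqrt (d / n) * δ := by
  set r := Real.sqrt (d / n) with hr
  have hr0 : 0 ≤ r := Real.sqrt_nonneg _
  have hr2 : d = n * r ^ 2 := by
    rw [hr, Real.sq_sqrt (by positivity)]
    field_simp
  have hnd : Real.sqrt (n * d) = n * r := by
    rw [hr2, show n * (n * r ^ 2) = (n * r) ^ 2 by ring, Real.sqrt_sq (by positivity)]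
  rw [hnd] at he hg
  have hu : 0 < p - 2 * d := by linarith
  have h2 : Real.sqrt 2 ≤ 2 * d := by
    have : Real.sqrt 2 ≤ 2 := Real.sqrt_le_iff.2 (by norm_num)
    linarith
  have ha : 0 ≤ δ * D * (2 * (n * r)) := by positivity
  have hb : (p - d) * e + g ≤ (p + d) * (δ * D * (2 * (n * r))) := by
    nlinarith [mul_le_mul_of_nonneg_left he (by linarith : 0 ≤ p - d),
      mul_le_mul_of_nonneg_right h2 ha]
  have hc : n * ((p - 2 * d) * D ^ 2) ≤
      n * (2 * d * r ^ 2 * δ ^ 2 + 4 * (p + d) * δ * D * r) := by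
    have hdd : d ^ 2 * δ ^ 2 = n * (d * r ^ 2 * δ ^ 2) := by
      calc d ^ 2 * δ ^ 2 = d * δ ^ 2 * d := by ring
        _ = d * δ ^ 2 * (n * r ^ 2) := by rw [← hr2]
        _ = _ := by ring
    nlinarith [mul_le_mul_of_nonneg_left hw hu.le]
  have hc' := le_of_mul_le_mul_left hc hn
  set c := (p + d) * r * δ with hcdef
  have hc0 : 0 ≤ c := by
    have : 0 ≤ p + d := by linarith
    positivity
  have hquad : ((p - 2 * d) * D - 2 * c) ^ 2 ≤ (Real.sqrt 5 * c) ^ 2 := by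
    rw [mul_pow, Real.sq_sqrt (by norm_num)]
    have h3 : 2 * d * (p - 2 * d) * (r * δ) ^ 2 ≤ (p + d) ^ 2 * (r * δ) ^ 2 :=
      mul_le_mul_of_nonneg_right (by nlinarith [sq_nonneg p, sq_nonneg d]) (sq_nonneg _)
    have h4 := mul_le_mul_of_nonneg_left hc' hu.le
    rw [hcdef]
    nlinarith
  have hfin := (abs_le_of_sq_le_sq' hquad (by positivity)).2
  rw [show (2 + Real.sqrt 5) * (p + d) / (p - 2 * d) * r * δ =
    (2 + Real.sqrt 5) * c / (p - 2 * d) by rw [hcdef]; ring, le_div_iff₀ hu]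
  linarith


/-- proximity condition for all second-order critical points when
`p ≥ 2d + 1` (Proposition 5.9). -/
theorem socp_proximity {n d p : ℕ} (hn : 2 ≤ n) (hd : 1 ≤ d) (hp : 2 * d + 1 ≤ p)
    (Δ : Matrix (Fin n × Fin d) (Fin n × Fin d) ℝ)
    (hΔsym : Δ.IsSymm) (hΔdiag : ∀ i, blk Δ i i = 0)
    (A : Matrix (Fin n × Fin d) (Fin n × Fin d) ℝ)
    (hA : A = Zmat n d * (Zmat n d)ᵀ + Δ)
    (S : Matrix (Fin n × Fin d) (Fin p) ℝ) (hS : secondOrderCrit A S) :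
    dF S ≤ (2 + Real.sqrt 5) * ((p : ℝ) + d) / ((p : ℝ) - 2 * d)
        * Real.sqrt ((d : ℝ) / n)
        * max (opNorm Δ) (opNorm (partialTrace Δ)) := by
  subst hA
  obtain ⟨hSt, hfo, hso⟩ := hS
  have hn0 : 0 < n := by omega
  obtain ⟨Q, hQ, hw⟩ := exists_frobNorm_sub_Zmat_mul_le hn0 hSt
  have hT := stiefelBlocks_Zmat_mul (n := n) hQ
  have hG := le_sum_finner_of_firstOrderCrit hn0 hSt hfo
  have hsn := signal_le_noise hSt hso hQ
  have he := abs_finner_gram_sub_le hΔsym S (Zmat n d * Q)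
  have hg := abs_finner_gram_sub_le (partialTrace_isSymm hΔsym) (projRows S)
    (projRows (Zmat n d * Q))
  rw [hSt.frobNorm_eq, hT.frobNorm_eq, ← two_mul] at he
  rw [frobNorm_projRows hSt, frobNorm_projRows hT, ← two_mul] at hg
  set δ := max (opNorm Δ) (opNorm (partialTrace Δ))
  have hδ1 : opNorm Δ ≤ δ := le_max_left _ _
  have hδ2 : opNorm (partialTrace Δ) ≤ δ := le_max_right _ _
  have hδ0 : 0 ≤ δ := (opNorm_nonneg Δ).trans hδ1
  have hD0 := frobNorm_nonneg (S - Zmat n d * Q)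
  have hd' : (1 : ℝ) ≤ d := by exact_mod_cast hd
  have hp' : 2 * (d : ℝ) < p := by exact_mod_cast hp
  refine (dF_le_frobNorm hQ).trans (le_of_signal_le_noise
    (e := finner Δ (S * Sᵀ) - finner Δ ((Zmat n d * Q) * (Zmat n d * Q)ᵀ))
    (g := -(finner (partialTrace Δ) (projRows S * (projRows S)ᵀ) -
      finner (partialTrace Δ) (projRows (Zmat n d * Q) * (projRows (Zmat n d * Q))ᵀ)))
    (by exact_mod_cast hn0) hd' hp' hδ0 hD0 ?_ ?_ ?_ hw)
  · have h1 := mul_le_mul_of_nonneg_left hG (by linarith : (0 : ℝ) ≤ d)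
    have h2 : opNorm Δ ^ 2 ≤ δ ^ 2 := pow_le_pow_left₀ (opNorm_nonneg Δ) hδ1 2
    have h3 := mul_le_mul_of_nonneg_left h2 (sq_nonneg (d : ℝ))
    linarith
  · refine (le_abs_self _).trans (he.trans ?_)
    gcongr
  · refine (neg_le_abs _).trans (hg.trans ?_)
    gcongr
    · exact frobNorm_nonneg _
    · exact frobNorm_projRows_sub_le hSt hT
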